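/- Let q be a prime power and suppose there exists a set of N three-dimensional subspaces of F_q^7 whose pairwise subspace distance is at least 4. Then there exists a set of N·q^8 + (q^4 + q^3 + 2q^2 + q + 1) three-dimensional subspaces of F_q^{11} whose pairwise subspace distance is at least 4; in other words, A_q(11,4,3) ≥ A_q(7,4,3)·q^8 + q^4 + q^3 + 2q^2 + q + 1. -/

import Mathlib

/-- The subspace distance `d_S(U,W) = 2·dim(U+W) − dim U − dim W` between two
subspaces of an `F`-vector space. -/
noncomputable def subspaceDist {F V : Type*} [Field F] [AddCommGroup V] [Module F V]
    (U W : Submodule F V) : ℕ :=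
  2 * Module.finrank F ↥(U ⊔ W) - Module.finrank F ↥U - Module.finrank F ↥W

/-- The row space `im(A)` of a matrix `A`, i.e. the span of its rows. -/
def rowSpace {F : Type*} [Field F] {k n : ℕ} (A : Matrix (Fin k) (Fin n) F) :
    Submodule F (Fin n → F) :=
  Submodule.span F (Set.range fun i : Fin k => A i)

/-- Horizontal concatenation `(U | M)` of two matrices with the same number of rows. -/
def hcat {F : Type*} [Field F] {k n1 n2 : ℕ} (U : Matrix (Fin k) (Fin n1) F)
    (M : Matrix (Fin k) (Fin n2) F) : Matrix (Fin k) (Fin (n1 + n2)) F :=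
  Matrix.of fun i => Fin.append (U i) (M i)

/-- The projection of `F^(n1+n2)` onto the first `n1` coordinates. -/
noncomputable def proj1 (F : Type*) [Field F] (n1 n2 : ℕ) :
    (Fin (n1 + n2) → F) →ₗ[F] (Fin n1 → F) :=
  LinearMap.funLeft F F (Fin.castAdd n2)

section

open Module

theorem four_le_subspaceDist {F V : Type*} [Field F] [AddCommGroup V] [Module F V]
    [FiniteDimensional F V] {U W : Submodule F V} (hU : finrank F U = 3) (hW : finrank F W = 3)
    (h : finrank F ↥(U ⊓ W) ≤ 1) : 4 ≤ subspaceDist U W := by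
  have := Submodule.finrank_sup_add_finrank_inf_eq U W
  unfold subspaceDist
  omega

theorem finrank_inf_le_one {F V : Type*} [Field F] [AddCommGroup V] [Module F V]
    [FiniteDimensional F V] {U W : Submodule F V} (hU : finrank F U = 3) (hW : finrank F W = 3)
    (h : 4 ≤ subspaceDist U W) : finrank F ↥(U ⊓ W) ≤ 1 := by
  have := Submodule.finrank_sup_add_finrank_inf_eq U W
  unfold subspaceDist at h
  omega

theorem finrank_submodule_prod {F V W : Type*} [Field F] [AddCommGroup V] [Module F V]
    [AddCommGroup W] [Module F W] [FiniteDimensional F V] [FiniteDimensional F W]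
    (U : Submodule F V) (L : Submodule F W) :
    finrank F ↥(U.prod L) = finrank F U + finrank F L := by
  have hinj : Function.Injective (U.subtype.prodMap L.subtype) :=
    Function.Injective.prodMap U.injective_subtype L.injective_subtype
  have hrange : LinearMap.range (U.subtype.prodMap L.subtype) = U.prod L := by
    simp [LinearMap.range_prodMap]
  rw [← hrange, LinearMap.finrank_range_of_inj hinj, finrank_prod]

theorem finrank_inf_lt_of_ne {F V : Type*} [Field F] [AddCommGroup V] [Module F V]
    [FiniteDimensional F V] {U W : Submodule F V} (hd : finrank F U = finrank F W)
    (h : U ≠ W) : finrank F ↥(U ⊓ W) < finrank F U := by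
  by_contra! hle
  have h1 := Submodule.eq_of_le_of_finrank_le inf_le_left hle
  have h2 := Submodule.eq_of_le_of_finrank_le inf_le_right (hd ▸ hle)
  exact h (h1.symm.trans h2)

theorem span_range_subtype_comp {F V : Type*} [Field F] [AddCommGroup V] [Module F V]
    [FiniteDimensional F V] {k : ℕ} (L : Submodule F V) (hL : finrank F L = k)
    {s : Fin k → L} (hs : LinearIndependent F s) :
    Submodule.span F (Set.range fun i => (s i : V)) = L := by
  have hs' : LinearIndependent F (fun i => (s i : V)) := hs.map' L.subtype L.ker_subtype
  refine Submodule.eq_of_le_of_finrank_eq ?_ ?_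
  · rw [Submodule.span_le]
    rintro _ ⟨i, rfl⟩
    exact (s i).2
  · rw [finrank_span_eq_card hs', hL, Fintype.card_fin]

/-- Counting linearly independent `k`-tuples by the subspace they span. -/
theorem card_subspaces_mul {F V : Type*} [Field F] [Fintype F] [AddCommGroup V] [Module F V]
    [Finite V] {k : ℕ} (hk : k ≤ finrank F V) :
    Nat.card {L : Submodule F V // finrank F L = k} *
      ∏ i : Fin k, (Fintype.card F ^ k - Fintype.card F ^ i.val) =
      ∏ i : Fin k, (Fintype.card F ^ finrank F V - Fintype.card F ^ i.val) := by
  classical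
  let f : (Σ L : {L : Submodule F V // finrank F L = k}, {s : Fin k → L.1 // LinearIndependent F s})
      → {s : Fin k → V // LinearIndependent F s} :=
    fun x => ⟨fun i => (x.2.1 i : V), x.2.2.map' x.1.1.subtype x.1.1.ker_subtype⟩
  have hf : Function.Bijective f := by
    constructor
    · rintro ⟨⟨L, hL⟩, s, hs⟩ ⟨⟨L', hL'⟩, s', hs'⟩ h
      have h1 : (fun i => (s i : V)) = fun i => (s' i : V) := congrArg Subtype.val h
      obtain rfl : L = L' := by
        rw [← span_range_subtype_comp L hL hs, ← span_range_subtype_comp L' hL' hs', h1]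
      obtain rfl : s = s' := by
        funext i
        exact Subtype.ext (congrFun h1 i)
      rfl
    · rintro ⟨s, hs⟩
      refine ⟨⟨⟨Submodule.span F (Set.range s), by
        rw [finrank_span_eq_card hs, Fintype.card_fin]⟩,
        fun i => ⟨s i, Submodule.subset_span ⟨i, rfl⟩⟩, ?_⟩, rfl⟩
      exact LinearIndependent.of_comp (Submodule.span F (Set.range s)).subtype hs
  have := Fintype.ofFinite {L : Submodule F V // finrank F L = k}
  rw [← card_linearIndependent hk, ← Nat.card_congr (Equiv.ofBijective f hf), Nat.card_sigma]
  have hfib (L : {L : Submodule F V // finrank F L = k}) :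
      Nat.card {s : Fin k → L.1 // LinearIndependent F s} =
        ∏ i : Fin k, (Fintype.card F ^ k - Fintype.card F ^ i.val) := by
    rw [card_linearIndependent L.2.ge, L.2]
  simp [hfib, Nat.card_eq_fintype_card]

theorem card_lines_of_finrank_eq_four {F V : Type*} [Field F] [Fintype F] [AddCommGroup V]
    [Module F V] [Finite V] (hV : finrank F V = 4) :
    Nat.card {L : Submodule F V // finrank F L = 2} =
      Fintype.card F ^ 4 + Fintype.card F ^ 3 + 2 * Fintype.card F ^ 2 + Fintype.card F + 1 := by
  have h := card_subspaces_mul (F := F) (V := V) (k := 2) (by omega)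
  have hq : 1 < Fintype.card F := Fintype.one_lt_card
  rw [hV] at h
  generalize Fintype.card F = q at *
  generalize Nat.card {L : Submodule F V // finrank F L = 2} = n at *
  simp only [Fin.prod_univ_two, Fin.val_zero, Fin.val_one, pow_zero, pow_one] at h
  have h1 : 1 ≤ q ^ 2 := Nat.one_le_pow _ _ (by omega)
  have h2 : 1 ≤ q ^ 4 := Nat.one_le_pow _ _ (by omega)
  have h3 : q ≤ q ^ 2 := Nat.le_self_pow (by omega) _
  have h4 : q ≤ q ^ 4 := Nat.le_self_pow (by omega) _
  zify [h1, h2, h3, h4] at h ⊢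
  have hq' : (1 : ℤ) < q := by exact_mod_cast hq
  have hne : ((q : ℤ) ^ 2 - 1) * ((q : ℤ) ^ 2 - q) ≠ 0 := by
    apply mul_ne_zero <;> nlinarith
  apply mul_right_cancel₀ hne
  rw [h]
  ring

/-- The linearized polynomial `a x + b x ^ q` as a linear map. -/
noncomputable def linearizedMap (F : Type*) {K : Type*} [Field F] [Fintype F] [Field K]
    [Algebra F K] (a b : K) : K →ₗ[F] K :=
  LinearMap.mulLeft F a + LinearMap.mulLeft F b ∘ₗ (FiniteField.frobeniusAlgHom F K).toLinearMap

theorem linearizedMap_apply {F K : Type*} [Field F] [Fintype F] [Field K] [Algebra F K]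
    (a b x : K) : linearizedMap F a b x = a * x + b * x ^ Fintype.card F := by
  simp [linearizedMap, FiniteField.coe_frobeniusAlgHom]

theorem finrank_ker_linearizedMap_le_one {F K : Type*} [Field F] [Fintype F] [Field K]
    [Algebra F K] [Finite K] {a b : K} (h : ¬ (a = 0 ∧ b = 0)) :
    finrank F (LinearMap.ker (linearizedMap F a b)) ≤ 1 := by
  classical
  have hq : 1 < Fintype.card F := Fintype.one_lt_card
  let p : Polynomial K := Polynomial.C a * Polynomial.X +
    Polynomial.C b * Polynomial.X ^ Fintype.card F
  have hp : p ≠ 0 := by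
    intro hp
    apply h
    have ha := congrArg (fun r => Polynomial.coeff r 1) hp
    have hb := congrArg (fun r => Polynomial.coeff r (Fintype.card F)) hp
    constructor
    · simpa [p, Polynomial.coeff_X_pow, hq.ne] using ha
    · simpa [p, Polynomial.coeff_X, hq.ne] using hb
  have hdeg : p.natDegree ≤ Fintype.card F := by
    simp only [p]
    refine Polynomial.natDegree_add_le_of_degree_le ?_ ?_
    · exact (Polynomial.natDegree_C_mul_le _ _).trans (by simpa using hq.le)
    · exact Polynomial.natDegree_C_mul_X_pow_le _ _
  have hsub : (LinearMap.ker (linearizedMap F a b) : Set K) ⊆ p.roots.toFinset := by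
    intro x hx
    have hx' : a * x + b * x ^ Fintype.card F = 0 := by
      rw [← linearizedMap_apply]; exact hx
    simp [hp, p, hx']
  have hcard : Nat.card (LinearMap.ker (linearizedMap F a b)) ≤ Fintype.card F := by
    calc Nat.card (LinearMap.ker (linearizedMap F a b))
        ≤ (p.roots.toFinset : Set K).ncard := Set.ncard_le_ncard hsub
      _ ≤ p.roots.card := by
        rw [Set.ncard_coe_finset]; exact Multiset.toFinset_card_le _
      _ ≤ _ := (p.card_roots').trans hdeg
  rw [Module.natCard_eq_pow_finrank (K := F), Nat.card_eq_fintype_card] at hcard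
  exact (Nat.pow_le_pow_iff_right hq).1 (by simpa using hcard)

/-- The graph of a linear map defined on a subspace. -/
def subspaceGraph {F V W : Type*} [Field F] [AddCommGroup V] [Module F V] [AddCommGroup W]
    [Module F W] (X : Submodule F V) (f : X →ₗ[F] W) : Submodule F (V × W) :=
  LinearMap.range (X.subtype.prod f)

section Graph

variable {F V W : Type*} [Field F] [AddCommGroup V] [Module F V] [AddCommGroup W] [Module F W]

theorem mem_subspaceGraph {X : Submodule F V} {f : X →ₗ[F] W} {z : V × W} :
    z ∈ subspaceGraph X f ↔ ∃ x : X, (x : V) = z.1 ∧ f x = z.2 := by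
  simp [subspaceGraph, Prod.ext_iff]

theorem finrank_subspaceGraph (X : Submodule F V) (f : X →ₗ[F] W) :
    finrank F (subspaceGraph X f) = finrank F X :=
  LinearMap.finrank_range_of_inj fun _ _ h => Subtype.ext (congrArg Prod.fst h)

variable [FiniteDimensional F V]

theorem finrank_subspaceGraph_inf_le {X U : Submodule F V} (f : X →ₗ[F] W)
    {P : Submodule F (V × W)} (hP : ∀ z ∈ P, z.1 ∈ U) :
    finrank F ↥(subspaceGraph X f ⊓ P) ≤ finrank F ↥(X ⊓ U) := by
  let g : ↥(subspaceGraph X f ⊓ P) →ₗ[F] ↥(X ⊓ U) :=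
    (LinearMap.fst F V W ∘ₗ (subspaceGraph X f ⊓ P).subtype).codRestrict _ fun z => by
      obtain ⟨x, hx, -⟩ := mem_subspaceGraph.1 z.2.1
      have hX : (z : V × W).1 ∈ X := hx ▸ x.2
      exact ⟨hX, hP _ z.2.2⟩
  refine LinearMap.finrank_le_finrank_of_injective (f := g) fun z w h => ?_
  have h1 : (z : V × W).1 = (w : V × W).1 := congrArg Subtype.val h
  obtain ⟨x, hx, hx'⟩ := mem_subspaceGraph.1 z.2.1
  obtain ⟨y, hy, hy'⟩ := mem_subspaceGraph.1 w.2.1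
  obtain rfl : x = y := Subtype.ext (hx.trans (h1.trans hy.symm))
  exact Subtype.ext (Prod.ext h1 (hx'.symm.trans hy'))

theorem finrank_subspaceGraph_inf_subspaceGraph_le {X : Submodule F V} (f g : X →ₗ[F] W) :
    finrank F ↥(subspaceGraph X f ⊓ subspaceGraph X g) ≤ finrank F (LinearMap.ker (f - g)) := by
  have hle : subspaceGraph X f ⊓ subspaceGraph X g ≤
      (LinearMap.ker (f - g)).map (X.subtype.prod f) := by
    rintro z ⟨hf, hg⟩
    obtain ⟨x, hx, hx'⟩ := mem_subspaceGraph.1 hf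
    obtain ⟨y, hy, hy'⟩ := mem_subspaceGraph.1 hg
    obtain rfl : x = y := Subtype.ext (hx.trans hy.symm)
    exact ⟨x, by simp [hx', hy'], Prod.ext hx hx'⟩
  exact (Submodule.finrank_mono hle).trans (Submodule.finrank_map_le _ _)

end Graph

theorem finrank_ker_comp_le {F U V W : Type*} [Field F] [AddCommGroup U] [Module F U]
    [AddCommGroup V] [Module F V] [AddCommGroup W] [Module F W] [FiniteDimensional F V]
    (f : V →ₗ[F] W) {g : U →ₗ[F] V} (hg : Function.Injective g) :
    finrank F (LinearMap.ker (f ∘ₗ g)) ≤ finrank F (LinearMap.ker f) :=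
  LinearMap.finrank_le_finrank_of_injective
    (f := (g ∘ₗ (LinearMap.ker (f ∘ₗ g)).subtype).codRestrict _ fun x => x.2)
    fun _ _ h => Subtype.ext (hg (congrArg Subtype.val h))

theorem span_cons_one_inf_span_cons_one {F : Type*} [Field F] {n : ℕ} {x y : Fin n → F}
    (h : x ≠ y) :
    Submodule.span F {(Fin.cons 1 x : Fin (n + 1) → F)} ⊓
      Submodule.span F {(Fin.cons 1 y : Fin (n + 1) → F)} = ⊥ := by
  rw [eq_bot_iff]
  rintro z ⟨hx, hy⟩
  obtain ⟨c, rfl⟩ := Submodule.mem_span_singleton.1 hx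
  obtain ⟨d, hd⟩ := Submodule.mem_span_singleton.1 hy
  obtain rfl : d = c := by simpa using congrFun hd 0
  by_cases hc : d = 0
  · simp [hc]
  · refine absurd (funext fun i => ?_) h
    have := congrFun hd i.succ
    simp only [Pi.smul_apply, Fin.cons_succ, smul_eq_mul] at this
    exact (mul_left_cancel₀ hc this).symm

/-- A family of planes pairwise meeting in dimension at most one, transported along a linear
equivalence, is a code of minimum subspace distance at least four. -/
theorem exists_code_of_family {F V W ι : Type*} [Field F] [AddCommGroup V] [Module F V]
    [AddCommGroup W] [Module F W] [FiniteDimensional F V] [FiniteDimensional F W]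
    (e : V ≃ₗ[F] W) (P : ι → Submodule F V) (hP : ∀ i, finrank F (P i) = 3)
    (hPP : ∀ i j, i ≠ j → finrank F ↥(P i ⊓ P j) ≤ 1) :
    ∃ S : Set (Submodule F W), S.ncard = Nat.card ι ∧ (∀ X ∈ S, finrank F X = 3) ∧
      ∀ X ∈ S, ∀ Y ∈ S, X ≠ Y → 4 ≤ subspaceDist X Y := by
  let Q : ι → Submodule F W := fun i => (P i).map e.toLinearMap
  have hQ (i) : finrank F (Q i) = 3 := (LinearEquiv.finrank_map_eq e (P i)).trans (hP i)
  refine ⟨Set.range Q, ?_, ?_, ?_⟩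
  · have hinj : Function.Injective Q := by
      intro i j hij
      by_contra hne
      have hPij : P i = P j := Submodule.map_injective_of_injective e.injective hij
      have := hPP i j hne
      rw [hPij, inf_idem, hP] at this
      omega
    rw [← Set.image_univ, Set.ncard_image_of_injective _ hinj, Set.ncard_univ]
  · rintro _ ⟨i, rfl⟩
    exact hQ i
  · rintro _ ⟨i, rfl⟩ _ ⟨j, rfl⟩ hne
    refine four_le_subspaceDist (hQ i) (hQ j) ?_
    rw [← Submodule.map_inf _ e.injective]
    exact (Submodule.finrank_map_le _ _).trans (hPP i j fun h => hne (congrArg Q h))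

theorem exists_field_extension (F : Type) [Field F] [Finite F] (n : ℕ) (hn : n ≠ 0) :
    ∃ (K : Type) (_ : Field K) (_ : Algebra F K), Finite K ∧ finrank F K = n := by
  obtain ⟨p, hp⟩ := CharP.exists F
  have : Fact p.Prime := ⟨CharP.char_is_prime F p⟩
  have : NeZero n := ⟨hn⟩
  exact ⟨FiniteField.Extension F p n, inferInstance, inferInstance, inferInstance,
    FiniteField.finrank_extension F p n⟩

end

theorem statement19 (q N : ℕ) (hq : IsPrimePow q)
    (F : Type) [Field F] [Fintype F] (hcard : Fintype.card F = q)
    (h : ∃ S : Set (Submodule F (Fin 7 → F)), S.ncard = N ∧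
      (∀ X ∈ S, Module.finrank F ↥X = 3) ∧
      (∀ X ∈ S, ∀ Y ∈ S, X ≠ Y → 4 ≤ subspaceDist X Y)) :
    ∃ S : Set (Submodule F (Fin 11 → F)),
      S.ncard = N * q ^ 8 + (q ^ 4 + q ^ 3 + 2 * q ^ 2 + q + 1) ∧
      (∀ X ∈ S, Module.finrank F ↥X = 3) ∧
      (∀ X ∈ S, ∀ Y ∈ S, X ≠ Y → 4 ≤ subspaceDist X Y) := by
  obtain ⟨S, hSN, hS3, hSd⟩ := h
  obtain ⟨K, _, _, _, hK⟩ := exists_field_extension F 4 (by norm_num)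
  have hq1 : 1 < q := hq.one_lt
  have hlines := card_lines_of_finrank_eq_four (F := F) (V := K) hK
  rw [hcard] at hlines
  have hKcard : Nat.card K = q ^ 4 := by
    rw [Module.natCard_eq_pow_finrank (K := F), hK, Nat.card_eq_fintype_card, hcard]
  have hemb : ∀ X : S, ∃ g : X.1 →ₗ[F] K, Function.Injective g := fun X =>
    finrank_le_iff_exists_linearMap.1 (by rw [hS3 X X.2, hK]; norm_num)
  choose g hg using hemb
  obtain ⟨v⟩ : Nonempty ({L : Submodule F K // Module.finrank F L = 2} ↪ (Fin 6 → F)) := by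
    have := Fintype.ofFinite {L : Submodule F K // Module.finrank F L = 2}
    refine Function.Embedding.nonempty_of_card_le ?_
    rw [← Nat.card_eq_fintype_card, hlines, Fintype.card_fun, hcard, Fintype.card_fin]
    nlinarith [pow_pos (by omega : 0 < q) 2, pow_pos (by omega : 0 < q) 3,
      pow_pos (by omega : 0 < q) 4, Nat.mul_le_mul hq1 hq1]
  let P : (S × K × K) ⊕ {L : Submodule F K // Module.finrank F L = 2} →
      Submodule F ((Fin 7 → F) × K) :=
    Sum.elim (fun x => subspaceGraph x.1.1 (linearizedMap F x.2.1 x.2.2 ∘ₗ g x.1))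
      (fun L => (Submodule.span F {(Fin.cons 1 (v L) : Fin 7 → F)}).prod L.1)
  have hspan (L) : Module.finrank F
      (Submodule.span F {(Fin.cons 1 (v L) : Fin 7 → F)}) = 1 :=
    finrank_span_singleton fun h0 => one_ne_zero (congrFun h0 0)
  have hmixed (x L) : Module.finrank F ↥(P (.inl x) ⊓ P (.inr L)) ≤ 1 :=
    (finrank_subspaceGraph_inf_le _ fun _ hz => (Submodule.mem_prod.1 hz).1).trans
      ((Submodule.finrank_mono inf_le_right).trans (hspan L).le)
  have hfin : Module.finrank F ((Fin 7 → F) × K) = Module.finrank F (Fin 11 → F) := by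
    rw [Module.finrank_prod, hK]; simp
  have hrank (i) : Module.finrank F (P i) = 3 := by
    rcases i with x | L
    · exact (finrank_subspaceGraph _ _).trans (hS3 _ x.1.2)
    · exact (finrank_submodule_prod _ _).trans (by rw [hspan, L.2])
  have hmeet (i j) (hne : i ≠ j) : Module.finrank F ↥(P i ⊓ P j) ≤ 1 := by
    obtain ⟨X, a, b⟩ | L := i <;> obtain ⟨Y, a', b'⟩ | L' := j
    · by_cases hXY : X = Y
      · subst hXY
        refine (finrank_subspaceGraph_inf_subspaceGraph_le _ _).trans ?_
        have hsub : linearizedMap F a b ∘ₗ g X - linearizedMap F a' b' ∘ₗ g X =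
            linearizedMap F (a - a') (b - b') ∘ₗ g X := by
          ext x
          simp only [LinearMap.sub_apply, LinearMap.comp_apply, linearizedMap_apply]
          ring
        rw [hsub]
        refine (finrank_ker_comp_le _ (hg X)).trans (finrank_ker_linearizedMap_le_one ?_)
        rintro ⟨ha, hb⟩
        exact hne (by rw [sub_eq_zero.1 ha, sub_eq_zero.1 hb])
      · refine (finrank_subspaceGraph_inf_le (U := Y.1) _ fun z hz => ?_).trans
          (finrank_inf_le_one (hS3 X X.2) (hS3 Y Y.2) (hSd X X.2 Y Y.2 fun h => hXY (Subtype.ext h)))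
        obtain ⟨y, hy, -⟩ := mem_subspaceGraph.1 hz
        exact hy ▸ y.2
    · exact hmixed _ _
    · rw [inf_comm]
      exact hmixed _ _
    · have hLL : L ≠ L' := fun h => hne (congrArg _ h)
      have hinf : P (.inr L) ⊓ P (.inr L') = Submodule.prod ⊥ (L.1 ⊓ L'.1) := by
        rw [← span_cons_one_inf_span_cons_one (v.injective.ne hLL), ← Submodule.prod_inf_prod]
        rfl
      rw [hinf, finrank_submodule_prod, finrank_bot]
      have := finrank_inf_lt_of_ne (L.2.trans L'.2.symm) fun h => hLL (Subtype.ext h)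
      rw [L.2] at this
      omega
  obtain ⟨T, hT, hT'⟩ := exists_code_of_family (LinearEquiv.ofFinrankEq _ _ hfin) P hrank hmeet
  refine ⟨T, ?_, hT'⟩
  rw [hT, Nat.card_sum, hlines, Nat.card_prod, Nat.card_prod, hKcard, Nat.card_coe_set_eq, hSN]
  ring
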